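/- Assume Hypothesis (H1), let β ≥ 0, let C_HP > 0 be a constant such that ∫_0^1 v²/σ ≤ C_HP ∫_0^1 (v')² for all v ∈ H¹_{1/σ,0}(0,1), and let y be a classical solution of the damped degenerate wave equation. Then for every T > s > 0 and every δ > 0, ∫_s^T y(t,1)² dt ≤ (2 + 2C_HP/(min_{[0,1]} η)³ + 1/δ + (1/δ)(max_{[0,1]} η + C_HP)/(min_{[0,1]} η)²) E_y(s) + 2δ (1/(min_{[0,1]} η)³ + 1) ∫_s^T E_y(t) dt. -/

import Mathlib

open MeasureTheory Set Filter Topology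

/-- The Feller weight `η(x) = exp (∫_{1/2}^x b/a)`. -/
noncomputable def etaW (a b : ℝ → ℝ) (x : ℝ) : ℝ :=
  Real.exp (∫ s in (1/2 : ℝ)..x, b s / a s)

/-- The weight `σ = a / η`. -/
noncomputable def sigW (a b : ℝ → ℝ) (x : ℝ) : ℝ :=
  a x / etaW a b x

/-- `u ∈ H¹(0,1)` with (a.e.) derivative `u'`. -/
structure MemH1 (u u' : ℝ → ℝ) : Prop where
  cont : ContinuousOn u (Set.Icc 0 1)
  hasDeriv : ∀ᵐ x ∂(volume.restrict (Set.Ioo (0:ℝ) 1)), HasDerivAt u (u' x) x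
  deriv_sq_int : IntegrableOn (fun x => (u' x) ^ 2) (Set.Ioo (0:ℝ) 1)
  ftc : ∀ x ∈ Set.Icc (0:ℝ) 1, u x = u 0 + ∫ t in Set.Ioo (0:ℝ) x, u' t

/-- `u ∈ L²_{1/σ}(0,1)`. -/
def MemL2sig (a b u : ℝ → ℝ) : Prop :=
  IntegrableOn (fun x => (u x) ^ 2) (Set.Ioo (0:ℝ) 1) ∧
  IntegrableOn (fun x => (u x) ^ 2 / sigW a b x) (Set.Ioo (0:ℝ) 1)

/-- `u ∈ H¹_{1/σ}(0,1)`. -/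
structure MemH1sig (a b u u' : ℝ → ℝ) extends MemH1 u u' : Prop where
  l2sig : MemL2sig a b u

/-- `u ∈ H¹_{1/σ,0}(0,1)`. -/
structure MemH1sig0 (a b u u' : ℝ → ℝ) extends MemH1sig a b u u' : Prop where
  zero : u 0 = 0

/-- `u ∈ H²_{1/σ}(0,1)`: `η u'` is locally absolutely continuous on `(0,1]`
with derivative `w`, and `Au = σ (η u')' = σ w ∈ L²_{1/σ}`. -/
structure MemH2sig (a b u u' w : ℝ → ℝ) extends MemH1sig a b u u' : Prop where
  w_locint : ∀ c ∈ Set.Ioc (0:ℝ) 1, IntegrableOn w (Set.Icc c 1)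
  locAC : ∀ c ∈ Set.Ioc (0:ℝ) 1, ∀ x ∈ Set.Icc c 1,
    etaW a b x * u' x = etaW a b c * u' c + ∫ t in Set.Ioo c x, w t
  Au_l2sig : MemL2sig a b (fun x => sigW a b x * w x)

/-- `u ∈ H²_{1/σ,0}(0,1)`. -/
structure MemH2sig0 (a b u u' w : ℝ → ℝ) extends MemH2sig a b u u' w : Prop where
  zero : u 0 = 0

/-- Hypothesis (H0): there is `K > 0` such that `x ↦ x^K / a x` is nondecreasing
in a right neighborhood of `0`. -/
def HypH0K (a : ℝ → ℝ) (K : ℝ) : Prop :=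
  0 < K ∧ ∃ ε > (0:ℝ), ∀ x y : ℝ, 0 < x → x ≤ y → y ≤ ε →
    x ^ K / a x ≤ y ^ K / a y

def HypH0 (a : ℝ → ℝ) : Prop := ∃ K : ℝ, HypH0K a K

/-- `a` is weakly degenerate at `0` with constant
`K = sup_{x ∈ (0,1]} x|a'(x)|/a(x) ∈ (0,1)`. -/
def IsWD (a a' : ℝ → ℝ) (K : ℝ) : Prop :=
  ContinuousOn a (Set.Icc 0 1) ∧ a 0 = 0 ∧ (∀ x ∈ Set.Ioc (0:ℝ) 1, 0 < a x) ∧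
  (∀ x ∈ Set.Ioc (0:ℝ) 1, HasDerivAt a (a' x) x) ∧
  ContinuousOn a' (Set.Ioc 0 1) ∧
  IsLUB ((fun x => x * |a' x| / a x) '' Set.Ioc (0:ℝ) 1) K ∧ 0 < K ∧ K < 1

/-- `a` is strongly degenerate at `0` with constant
`K = sup_{x ∈ (0,1]} x|a'(x)|/a(x) ∈ [1,2)`. -/
def IsSD (a a' : ℝ → ℝ) (K : ℝ) : Prop :=
  ContinuousOn a (Set.Icc 0 1) ∧ a 0 = 0 ∧ (∀ x ∈ Set.Ioc (0:ℝ) 1, 0 < a x) ∧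
  (∀ x ∈ Set.Icc (0:ℝ) 1, HasDerivWithinAt a (a' x) (Set.Icc 0 1) x) ∧
  ContinuousOn a' (Set.Icc 0 1) ∧
  IsLUB ((fun x => x * |a' x| / a x) '' Set.Ioc (0:ℝ) 1) K ∧ 1 ≤ K ∧ K < 2

/-- Hypothesis (H1): `b/a ∈ L¹(0,1)`, `b` continuous, `a` is (WD) or (SD) with
constant `K`, and if `K > 1` then `x b(x)/a(x) ∈ L^∞(0,1)`. -/
def HypH1 (a a' b : ℝ → ℝ) (K : ℝ) : Prop :=
  (IsWD a a' K ∨ IsSD a a' K) ∧ ContinuousOn b (Set.Icc 0 1) ∧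
  MeasureTheory.IntegrableOn (fun x => b x / a x) (Set.Ioo (0:ℝ) 1) ∧
  (1 < K → ∃ M : ℝ, ∀ x ∈ Set.Ioo (0:ℝ) 1, |x * b x / a x| ≤ M)

/-- Hypothesis (H2): (H1) and `(2-K) a(x) - 2x|b(x)| ≥ ε₀ a(x)` on `[0,1]`. -/
def HypH2 (a a' b : ℝ → ℝ) (K ε₀ : ℝ) : Prop :=
  HypH1 a a' b K ∧ 0 < ε₀ ∧
  ∀ x ∈ Set.Icc (0:ℝ) 1, ε₀ * a x ≤ (2 - K) * a x - 2 * x * |b x|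

/-- A classical solution of the damped degenerate wave equation
`y_tt = a y_xx + b y_x`, `y(t,0) = 0`, `y_t(t,1) + η(1) y_x(t,1) + β y(t,1) = 0`,
with the regularity, integrability and differentiation-under-the-integral
properties required of classical solutions. -/
structure ClassicalSol (a b : ℝ → ℝ) (β : ℝ)
    (y yt yx ytt ytx yxx : ℝ → ℝ → ℝ) : Prop where
  dt : ∀ t x, 0 ≤ t → x ∈ Set.Icc (0:ℝ) 1 → HasDerivAt (fun s => y s x) (yt t x) t
  dtt : ∀ t x, 0 ≤ t → x ∈ Set.Icc (0:ℝ) 1 → HasDerivAt (fun s => yt s x) (ytt t x) t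
  dx : ∀ t x, 0 ≤ t → x ∈ Set.Ioc (0:ℝ) 1 → HasDerivAt (fun ξ => y t ξ) (yx t x) x
  dtx : ∀ t x, 0 ≤ t → x ∈ Set.Ioc (0:ℝ) 1 → HasDerivAt (fun ξ => yt t ξ) (ytx t x) x
  dxx : ∀ t x, 0 ≤ t → x ∈ Set.Ioc (0:ℝ) 1 → HasDerivAt (fun ξ => yx t ξ) (yxx t x) x
  cont_tt : ContinuousOn (Function.uncurry ytt) (Set.Ici 0 ×ˢ Set.Ioc (0:ℝ) 1)
  cont_tx : ContinuousOn (Function.uncurry ytx) (Set.Ici 0 ×ˢ Set.Ioc (0:ℝ) 1)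
  cont_xx : ContinuousOn (Function.uncurry yxx) (Set.Ici 0 ×ˢ Set.Ioc (0:ℝ) 1)
  pde : ∀ t x, 0 < t → x ∈ Set.Ioo (0:ℝ) 1 → ytt t x = a x * yxx t x + b x * yx t x
  bc0 : ∀ t, 0 ≤ t → y t 0 = 0
  bc1 : ∀ t, 0 < t → yt t 1 + etaW a b 1 * yx t 1 + β * y t 1 = 0
  regx : ∀ t, 0 ≤ t → MemH2sig0 a b (y t) (yx t)
    (fun x => etaW a b x * (b x / a x * yx t x + yxx t x))
  regt : ∀ t, 0 ≤ t → MemH1sig0 a b (yt t) (ytx t)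
  ediff : ∀ t, 0 ≤ t → HasDerivAt
    (fun s => ∫ x in Set.Ioo (0:ℝ) 1,
      ((yt s x) ^ 2 / sigW a b x + etaW a b x * (yx s x) ^ 2))
    (∫ x in Set.Ioo (0:ℝ) 1,
      (2 * yt t x * ytt t x / sigW a b x + 2 * etaW a b x * yx t x * ytx t x)) t
  intQ : ∀ s T : ℝ, 0 < s → s < T →
    MeasureTheory.IntegrableOn
      (fun p : ℝ × ℝ => (yt p.1 p.2) ^ 2 / sigW a b p.2)
      (Set.Ioo s T ×ˢ Set.Ioo (0:ℝ) 1) ∧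
    MeasureTheory.IntegrableOn
      (fun p : ℝ × ℝ => etaW a b p.2 * (yx p.1 p.2) ^ 2)
      (Set.Ioo s T ×ˢ Set.Ioo (0:ℝ) 1)
  intBdry : ∀ s T : ℝ, 0 < s → s < T →
    MeasureTheory.IntegrableOn (fun t => (yt t 1) ^ 2) (Set.Ioo s T) ∧
    MeasureTheory.IntegrableOn (fun t => (yx t 1) ^ 2) (Set.Ioo s T) ∧
    MeasureTheory.IntegrableOn (fun t => (y t 1) ^ 2) (Set.Ioo s T)

/-- The energy of a solution `y`:
`E_y(t) = (1/2) [∫₀¹ (y_t²/σ + η y_x²) dx + β y(t,1)²]`. -/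
noncomputable def energy (a b : ℝ → ℝ) (β : ℝ) (y yt yx : ℝ → ℝ → ℝ) (t : ℝ) : ℝ :=
  (1/2) * ((∫ x in Set.Ioo (0:ℝ) 1,
    ((yt t x) ^ 2 / sigW a b x + etaW a b x * (yx t x) ^ 2)) + β * (y t 1) ^ 2)

/-- A function dominated near `0` by `x * k x` with `k` integrable can only tend to `0`. -/
theorem eq_zero_of_tendsto_of_abs_le_mul {f k : ℝ → ℝ} {L : ℝ}
    (hf : Tendsto f (𝓝[>] 0) (𝓝 L)) (hk : IntegrableOn k (Ioo 0 1))
    (h : ∀ᵐ x ∂volume.restrict (Ioo (0:ℝ) 1), |f x| ≤ x * k x) : L = 0 := by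
  by_contra hL
  have hL' : 0 < |L| := abs_pos.2 hL
  have ev : ∀ᶠ x in 𝓝[>] (0:ℝ), |L| / 2 < |f x| :=
    hf.abs.eventually_const_lt (half_lt_self hL')
  obtain ⟨d, hd, hsub⟩ := mem_nhdsGT_iff_exists_Ioo_subset.1 ev
  have hd : 0 < d := hd
  set e := min d 1 with he
  have he0 : 0 < e := lt_min hd one_pos
  have hI : IntegrableOn (fun x : ℝ => x⁻¹) (Ioo 0 e) := by
    have hke : IntegrableOn k (Ioo 0 e) :=
      hk.mono_set (Ioo_subset_Ioo_right (min_le_right _ _))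
    refine Integrable.mono' (hke.const_mul (2 / |L|)) measurable_inv.aestronglyMeasurable ?_
    have h' := ae_restrict_of_ae_restrict_of_subset
      (Ioo_subset_Ioo_right (min_le_right d 1) : Ioo (0:ℝ) e ⊆ Ioo 0 1) h
    filter_upwards [h', ae_restrict_mem measurableSet_Ioo] with x hx hxe
    have h1 : |L| / 2 < |f x| := hsub ⟨hxe.1, hxe.2.trans_le (min_le_left _ _)⟩
    have hx0 : 0 < x := hxe.1
    rw [Real.norm_of_nonneg (inv_nonneg.2 hx0.le), div_mul_eq_mul_div, le_div_iff₀ hL',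
      inv_mul_le_iff₀ hx0]
    linarith
  have h2 : IntervalIntegrable (fun x : ℝ => x⁻¹) volume 0 e :=
    (intervalIntegrable_iff_integrableOn_Ioo_of_le he0.le).2 hI
  rcases intervalIntegrable_inv_iff.1 h2 with h3 | h3
  · exact he0.ne h3
  · exact h3 left_mem_uIcc

theorem nhdsGT_zero_le : 𝓝[>] (0:ℝ) ≤ 𝓝[Icc 0 1] 0 := by
  rw [← nhdsWithin_Ioo_eq_nhdsGT (zero_lt_one (α := ℝ))]
  exact nhdsWithin_mono _ Ioo_subset_Icc_self

theorem eventually_mem_Ioo_nhdsGT : ∀ᶠ x in 𝓝[>] (0:ℝ), x ∈ Ioo (0:ℝ) 1 :=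
  Ioo_mem_nhdsGT one_pos

theorem tendsto_integral_left {f : ℝ → ℝ} (hf : IntegrableOn f (Ioo 0 1)) :
    Tendsto (fun ε => ∫ x in ε..1, f x) (𝓝[>] 0) (𝓝 (∫ x in Ioo (0:ℝ) 1, f x)) := by
  have h0 : IntervalIntegrable f volume 0 1 :=
    (intervalIntegrable_iff_integrableOn_Ioo_of_le zero_le_one).2 hf
  have hc := intervalIntegral.continuousOn_primitive_interval_left
    (f := f) (μ := volume) (a := 0) (b := 1)
    (by rw [uIcc_of_le zero_le_one, integrableOn_Icc_iff_integrableOn_Ioo]; exact hf)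
  rw [uIcc_of_le zero_le_one] at hc
  have := (hc 0 (by simp)).mono_left nhdsGT_zero_le
  simpa only [intervalIntegral.integral_of_le zero_le_one, integral_Ioc_eq_integral_Ioo] using this

/-- Fundamental theorem of calculus on `(0,1)` with the boundary term at `0` discarded. -/
theorem integral_Ioo_eq_of_sq_le {F f k : ℝ → ℝ}
    (hF : ContinuousOn F (Ioc 0 1)) (hd : ∀ x ∈ Ioo (0:ℝ) 1, HasDerivAt F (f x) x)
    (hf : IntegrableOn f (Ioo 0 1)) (hk : IntegrableOn k (Ioo 0 1))
    (hFk : ∀ x ∈ Ioo (0:ℝ) 1, F x ^ 2 ≤ x * k x) :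
    ∫ x in Ioo (0:ℝ) 1, f x = F 1 := by
  have hlim : Tendsto F (𝓝[>] 0) (𝓝 (F 1 - ∫ x in Ioo (0:ℝ) 1, f x)) := by
    refine (tendsto_const_nhds.sub (tendsto_integral_left hf)).congr' ?_
    filter_upwards [eventually_mem_Ioo_nhdsGT] with ε hε
    rw [intervalIntegral.integral_eq_sub_of_hasDerivAt_of_le hε.2.le
      (hF.mono fun x hx => ⟨hε.1.trans_le hx.1, hx.2⟩)
      (fun x hx => hd x ⟨hε.1.trans hx.1, hx.2⟩)]
    · ring
    · exact (intervalIntegrable_iff_integrableOn_Ioo_of_le hε.2.le).2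
        (hf.mono_set (Ioo_subset_Ioo_left hε.1.le))
  have := eq_zero_of_tendsto_of_abs_le_mul (hlim.pow 2) hk (by
    filter_upwards [ae_restrict_mem measurableSet_Ioo] with x hx
    rw [abs_of_nonneg (sq_nonneg _)]
    exact hFk x hx)
  have := pow_eq_zero_iff two_ne_zero |>.1 this
  linarith

theorem sq_integral_Ioo_le {f : ℝ → ℝ} {x : ℝ} (hx : 0 < x)
    (hf : AEStronglyMeasurable f (volume.restrict (Ioo 0 x)))
    (hf2 : IntegrableOn (fun t => f t ^ 2) (Ioo 0 x)) :
    (∫ t in Ioo 0 x, f t) ^ 2 ≤ x * ∫ t in Ioo 0 x, f t ^ 2 := by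
  have hc : ∀ c : ℝ, IntegrableOn (fun _ : ℝ => c) (Ioo 0 x) := fun c => by simp
  have h1 : IntegrableOn f (Ioo 0 x) := by
    refine Integrable.mono' ((hc 1).add hf2) hf (ae_of_all _ fun t => ?_)
    simp only [Pi.add_apply, Real.norm_eq_abs]
    nlinarith [sq_nonneg (|f t| - 1), sq_abs (f t)]
  set I := ∫ t in Ioo 0 x, f t
  have h2 : 0 ≤ ∫ t in Ioo 0 x, (f t ^ 2 - 2 * (I / x) * f t + (I / x) ^ 2) :=
    integral_nonneg fun t => by
      have := sq_nonneg (f t - I / x)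
      simp only [Pi.zero_apply]
      linarith
  have h3 : ∫ t in Ioo 0 x, (f t ^ 2 - 2 * (I / x) * f t + (I / x) ^ 2)
      = (∫ t in Ioo 0 x, f t ^ 2) - 2 * (I / x) * I + x * (I / x) ^ 2 := by
    have e1 : IntegrableOn (fun t => f t ^ 2 - 2 * (I / x) * f t) (Ioo 0 x) :=
      hf2.sub (h1.const_mul _)
    rw [integral_add e1 (hc _), integral_sub hf2 (h1.const_mul _), integral_const_mul]
    simp [hx.le, I]
  rw [h3] at h2
  have h4 : x * (∫ t in Ioo 0 x, f t ^ 2) - I ^ 2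
      = x * ((∫ t in Ioo 0 x, f t ^ 2) - 2 * (I / x) * I + x * (I / x) ^ 2) := by
    field_simp; ring
  nlinarith [mul_nonneg hx.le h2]

section Weight

variable {a a' b : ℝ → ℝ} {K : ℝ}

theorem HypH1.coeff (h : HypH1 a a' b K) :
    ContinuousOn a (Icc 0 1) ∧ (∀ x ∈ Ioc (0:ℝ) 1, 0 < a x) ∧
    (∀ x ∈ Ioo (0:ℝ) 1, HasDerivAt a (a' x) x) ∧
    ∀ x ∈ Ioc (0:ℝ) 1, x * |a' x| ≤ 2 * a x := by
  have key : ∀ {k : ℝ}, k < 2 → (∀ x ∈ Ioc (0:ℝ) 1, 0 < a x) →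
      IsLUB ((fun x => x * |a' x| / a x) '' Ioc (0:ℝ) 1) k →
      ∀ x ∈ Ioc (0:ℝ) 1, x * |a' x| ≤ 2 * a x := fun hk hpos hlub x hx => by
    have h1 := hlub.1 (mem_image_of_mem _ hx)
    rw [div_le_iff₀ (hpos x hx)] at h1
    nlinarith [hpos x hx]
  rcases h.1 with ⟨h1, -, h3, h4, -, h6, -, h8⟩ | ⟨h1, -, h3, h4, -, h6, -, h8⟩
  · exact ⟨h1, h3, fun x hx => h4 x ⟨hx.1, hx.2.le⟩, key (by linarith) h3 h6⟩
  · exact ⟨h1, h3, fun x hx => (h4 x ⟨hx.1.le, hx.2.le⟩).hasDerivAt (Icc_mem_nhds hx.1 hx.2),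
      key h8 h3 h6⟩

theorem HypH1.mul_sq_le (h : HypH1 a a' b K) {x : ℝ} (hx : x ∈ Ioc (0:ℝ) 1) :
    a 1 * x ^ 2 ≤ a x := by
  obtain ⟨hc, -, hd, hK⟩ := h.coeff
  have hanti : AntitoneOn (fun x => a x / x ^ 2) (Ioc 0 1) := by
    refine antitoneOn_of_hasDerivWithinAt_nonpos (convex_Ioc 0 1)
      (f' := fun x => (a' x * x ^ 2 - a x * (2 * x)) / (x ^ 2) ^ 2)
      ((hc.mono Ioc_subset_Icc_self).div (continuousOn_pow 2)
        fun x hx => pow_ne_zero 2 hx.1.ne') ?_ ?_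
    · intro x hx
      rw [interior_Ioc] at hx
      have h2 : HasDerivAt (fun x : ℝ => x ^ 2) (2 * x) x := by simpa using hasDerivAt_pow 2 x
      exact ((hd x hx).div h2 (pow_ne_zero 2 hx.1.ne')).hasDerivWithinAt
    · intro x hx
      rw [interior_Ioc] at hx
      have h1 := hK x ⟨hx.1, hx.2.le⟩
      have h2 : x * a' x ≤ x * |a' x| := mul_le_mul_of_nonneg_left (le_abs_self _) hx.1.le
      refine div_nonpos_of_nonpos_of_nonneg ?_ (by positivity)
      nlinarith [hx.1]
  have := hanti hx ⟨one_pos, le_rfl⟩ hx.2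
  simp only [one_pow, div_one] at this
  rwa [le_div_iff₀ (pow_pos hx.1 2)] at this

theorem etaW_pos (a b : ℝ → ℝ) (x : ℝ) : 0 < etaW a b x := Real.exp_pos _

theorem HypH1.intervalIntegrable (h : HypH1 a a' b K) {x : ℝ} (hx : x ∈ Icc (0:ℝ) 1) :
    IntervalIntegrable (fun s => b s / a s) volume (1/2) x :=
  ((intervalIntegrable_iff_integrableOn_Ioo_of_le zero_le_one).2 h.2.2.1).mono_set
    (uIcc_subset_uIcc (by rw [uIcc_of_le zero_le_one]; norm_num)
      (by rwa [uIcc_of_le zero_le_one]))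

theorem HypH1.continuousOn_etaW (h : HypH1 a a' b K) : ContinuousOn (etaW a b) (Icc 0 1) := by
  have h0 : IntervalIntegrable (fun s => b s / a s) volume 0 1 :=
    (intervalIntegrable_iff_integrableOn_Ioo_of_le zero_le_one).2 h.2.2.1
  have := intervalIntegral.continuousOn_primitive_interval' h0 (a := 1/2)
    (by rw [uIcc_of_le zero_le_one]; norm_num)
  rw [uIcc_of_le zero_le_one] at this
  exact Real.continuous_exp.comp_continuousOn this

theorem HypH1.continuousOn_div (h : HypH1 a a' b K) :
    ContinuousOn (fun x => b x / a x) (Ioc 0 1) :=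
  (h.2.1.mono Ioc_subset_Icc_self).div (h.coeff.1.mono Ioc_subset_Icc_self)
    fun x hx => (h.coeff.2.1 x hx).ne'

theorem HypH1.hasDerivAt_etaW (h : HypH1 a a' b K) {x : ℝ} (hx : x ∈ Ioo (0:ℝ) 1) :
    HasDerivAt (etaW a b) (etaW a b x * (b x / a x)) x := by
  have hc := h.continuousOn_div.mono Ioo_subset_Ioc_self
  exact (intervalIntegral.integral_hasDerivAt_right (h.intervalIntegrable ⟨hx.1.le, hx.2.le⟩)
    (hc.stronglyMeasurableAtFilter isOpen_Ioo x hx)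
    (hc.continuousAt (isOpen_Ioo.mem_nhds hx))).exp

theorem HypH1.sInf_etaW_le (h : HypH1 a a' b K) {x : ℝ} (hx : x ∈ Icc (0:ℝ) 1) :
    sInf (etaW a b '' Icc 0 1) ≤ etaW a b x :=
  csInf_le (isCompact_Icc.image_of_continuousOn h.continuousOn_etaW).bddBelow
    (mem_image_of_mem _ hx)

theorem HypH1.sInf_etaW_pos (h : HypH1 a a' b K) : 0 < sInf (etaW a b '' Icc 0 1) := by
  obtain ⟨x, -, hx⟩ := (isCompact_Icc.image_of_continuousOn h.continuousOn_etaW).sInf_mem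
    ((nonempty_Icc.2 zero_le_one).image _)
  rw [← hx]
  exact etaW_pos a b x

theorem HypH1.sSup_etaW_nonneg (h : HypH1 a a' b K) : 0 ≤ sSup (etaW a b '' Icc 0 1) :=
  (etaW_pos a b 0).le.trans <|
    le_csSup (isCompact_Icc.image_of_continuousOn h.continuousOn_etaW).bddAbove
      (mem_image_of_mem _ (by simp))

theorem HypH1.sigW_pos (h : HypH1 a a' b K) {x : ℝ} (hx : x ∈ Ioc (0:ℝ) 1) :
    0 < sigW a b x :=
  div_pos (h.coeff.2.1 x hx) (etaW_pos a b x)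

theorem HypH1.continuousOn_sigW (h : HypH1 a a' b K) : ContinuousOn (sigW a b) (Icc 0 1) :=
  h.coeff.1.div h.continuousOn_etaW fun x _ => (etaW_pos a b x).ne'

/-- The primitive `∫₀ˣ 1/η`, which solves the stationary equation `(η v')' = 0`, `v(0) = 0`. -/
noncomputable def scaleW (a b : ℝ → ℝ) (x : ℝ) : ℝ :=
  ∫ r in (0:ℝ)..x, (etaW a b r)⁻¹

theorem HypH1.continuousOn_inv_etaW (h : HypH1 a a' b K) :
    ContinuousOn (fun x => (etaW a b x)⁻¹) (Icc 0 1) :=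
  h.continuousOn_etaW.inv₀ fun x _ => (etaW_pos a b x).ne'

theorem HypH1.intervalIntegrable_inv_etaW (h : HypH1 a a' b K) {x : ℝ}
    (hx : x ∈ Icc (0:ℝ) 1) : IntervalIntegrable (fun x => (etaW a b x)⁻¹) volume 0 x :=
  ContinuousOn.intervalIntegrable_of_Icc hx.1
    (h.continuousOn_inv_etaW.mono (Icc_subset_Icc_right hx.2))

theorem HypH1.continuousOn_scaleW (h : HypH1 a a' b K) :
    ContinuousOn (scaleW a b) (Icc 0 1) := by
  have := intervalIntegral.continuousOn_primitive_interval'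
    (h.intervalIntegrable_inv_etaW (right_mem_Icc.2 zero_le_one)) (a := 0) left_mem_uIcc
  rwa [uIcc_of_le zero_le_one] at this

theorem HypH1.hasDerivAt_scaleW (h : HypH1 a a' b K) {x : ℝ} (hx : x ∈ Ioo (0:ℝ) 1) :
    HasDerivAt (scaleW a b) (etaW a b x)⁻¹ x := by
  have hc := h.continuousOn_inv_etaW.mono Ioo_subset_Icc_self
  exact intervalIntegral.integral_hasDerivAt_right
    (h.intervalIntegrable_inv_etaW ⟨hx.1.le, hx.2.le⟩)
    (hc.stronglyMeasurableAtFilter isOpen_Ioo x hx)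
    (hc.continuousAt (isOpen_Ioo.mem_nhds hx))

theorem HypH1.scaleW_nonneg {x : ℝ} (hx : 0 ≤ x) : 0 ≤ scaleW a b x :=
  intervalIntegral.integral_nonneg hx fun r _ => (inv_pos.2 (etaW_pos a b r)).le

theorem HypH1.scaleW_le (h : HypH1 a a' b K) {x : ℝ} (hx : x ∈ Icc (0:ℝ) 1) :
    scaleW a b x ≤ x / sInf (etaW a b '' Icc 0 1) := by
  have := intervalIntegral.integral_mono_on hx.1 (h.intervalIntegrable_inv_etaW hx)
    (intervalIntegrable_const (c := (sInf (etaW a b '' Icc 0 1))⁻¹)) fun r hr =>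
      inv_anti₀ h.sInf_etaW_pos (h.sInf_etaW_le ⟨hr.1, hr.2.trans hx.2⟩)
  simpa [scaleW, div_eq_mul_inv] using this

theorem HypH1.integrableOn_scaleW_sq_div (h : HypH1 a a' b K) :
    IntegrableOn (fun x => scaleW a b x ^ 2 / sigW a b x) (Ioo 0 1) := by
  set m := sInf (etaW a b '' Icc 0 1)
  have hm : 0 < m := h.sInf_etaW_pos
  have ha1 : 0 < a 1 := h.coeff.2.1 1 (by simp)
  have hη : IntegrableOn (etaW a b) (Ioo 0 1) :=
    (h.continuousOn_etaW.integrableOn_Icc).mono_set Ioo_subset_Icc_self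
  refine Integrable.mono' (hη.const_mul (1 / (m ^ 2 * a 1))) ?_ ?_
  · exact (ContinuousOn.div ((h.continuousOn_scaleW.pow 2).mono Ioo_subset_Icc_self)
      (h.continuousOn_sigW.mono Ioo_subset_Icc_self)
      fun x hx => (h.sigW_pos (Ioo_subset_Ioc_self hx)).ne').aestronglyMeasurable
        measurableSet_Ioo
  · filter_upwards [ae_restrict_mem measurableSet_Ioo] with x hx
    have hx' := Ioo_subset_Ioc_self hx
    have hG := h.scaleW_le (Ioo_subset_Icc_self hx)
    have hG0 : 0 ≤ scaleW a b x := HypH1.scaleW_nonneg hx.1.le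
    have hax : 0 < a x := h.coeff.2.1 x hx'
    have h1 : scaleW a b x ^ 2 * (m ^ 2 * a 1) ≤ a x := by
      rw [le_div_iff₀ hm] at hG
      have : (scaleW a b x * m) ^ 2 ≤ x ^ 2 := pow_le_pow_left₀ (by positivity) hG 2
      nlinarith [h.mul_sq_le hx']
    rw [Real.norm_of_nonneg (div_nonneg (sq_nonneg _) (h.sigW_pos hx').le), sigW,
      div_div_eq_mul_div, div_le_iff₀ hax, one_div, mul_assoc, ← div_eq_inv_mul,
      le_div_iff₀ (by positivity)]
    nlinarith [etaW_pos a b x]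

theorem HypH1.memH1sig0_scaleW (h : HypH1 a a' b K) :
    MemH1sig0 a b (scaleW a b) (fun x => (etaW a b x)⁻¹) where
  cont := h.continuousOn_scaleW
  hasDeriv := by
    filter_upwards [ae_restrict_mem measurableSet_Ioo] with x hx using h.hasDerivAt_scaleW hx
  deriv_sq_int := (h.continuousOn_inv_etaW.pow 2).integrableOn_Icc.mono_set Ioo_subset_Icc_self
  ftc x hx := by
    simp [scaleW, intervalIntegral.integral_of_le hx.1, integral_Ioc_eq_integral_Ioo]
  l2sig := ⟨(h.continuousOn_scaleW.pow 2).integrableOn_Icc.mono_set Ioo_subset_Icc_self,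
    h.integrableOn_scaleW_sq_div⟩
  zero := by simp [scaleW]

/-- The Hardy–Poincaré inequality applied to `∫₀ˣ 1/η`. -/
theorem HypH1.integral_scaleW_sq_div_le (h : HypH1 a a' b K) {C : ℝ} (hC : 0 < C)
    (hHP : ∀ v v' : ℝ → ℝ, MemH1sig0 a b v v' →
      ∫ x in Ioo (0:ℝ) 1, (v x) ^ 2 / sigW a b x ≤ C * ∫ x in Ioo (0:ℝ) 1, (v' x) ^ 2) :
    ∫ x in Ioo (0:ℝ) 1, scaleW a b x ^ 2 / sigW a b x
      ≤ C / sInf (etaW a b '' Icc 0 1) ^ 2 := by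
  refine (hHP _ _ h.memH1sig0_scaleW).trans ?_
  rw [div_eq_mul_inv]
  refine mul_le_mul_of_nonneg_left ?_ hC.le
  have := setIntegral_mono_on h.memH1sig0_scaleW.deriv_sq_int
    (integrableOn_const (C := (sInf (etaW a b '' Icc 0 1) ^ 2)⁻¹) (by simp))
    measurableSet_Ioo fun x hx => by
      rw [inv_pow]
      exact inv_anti₀ (pow_pos h.sInf_etaW_pos 2)
        (pow_le_pow_left₀ h.sInf_etaW_pos.le (h.sInf_etaW_le (Ioo_subset_Icc_self hx)) 2)
  simpa using this

end Weight

theorem integrableOn_mul_of_sq {f g : ℝ → ℝ} {s : Set ℝ}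
    (hf : AEStronglyMeasurable f (volume.restrict s))
    (hg : AEStronglyMeasurable g (volume.restrict s))
    (hf2 : IntegrableOn (fun x => f x ^ 2) s) (hg2 : IntegrableOn (fun x => g x ^ 2) s) :
    IntegrableOn (fun x => f x * g x) s := by
  refine Integrable.mono' (hf2.add hg2) (hf.mul hg) (ae_of_all _ fun x => ?_)
  simp only [Pi.add_apply, Real.norm_eq_abs, abs_mul]
  nlinarith [sq_nonneg (|f x| - |g x|), sq_abs (f x), sq_abs (g x), sq_nonneg (f x),
    sq_nonneg (g x)]

theorem integrableOn_continuousOn_mul {c f : ℝ → ℝ} (hc : ContinuousOn c (Icc 0 1))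
    (hf : IntegrableOn f (Ioo 0 1)) : IntegrableOn (fun x => c x * f x) (Ioo 0 1) := by
  rw [← integrableOn_Icc_iff_integrableOn_Ioo] at hf ⊢
  exact hf.continuousOn_mul hc isCompact_Icc

theorem HypH1.integrableOn_mul_div {a a' b : ℝ → ℝ} {K : ℝ} (h : HypH1 a a' b K)
    {u v : ℝ → ℝ} (hu : ContinuousOn u (Ioo 0 1)) (hv : ContinuousOn v (Ioo 0 1))
    (hu2 : IntegrableOn (fun x => u x ^ 2 / sigW a b x) (Ioo 0 1))
    (hv2 : IntegrableOn (fun x => v x ^ 2 / sigW a b x) (Ioo 0 1)) :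
    IntegrableOn (fun x => u x * v x / sigW a b x) (Ioo 0 1) := by
  have hσ : ∀ x ∈ Ioo (0:ℝ) 1, 0 < sigW a b x := fun x hx => h.sigW_pos (Ioo_subset_Ioc_self hx)
  refine Integrable.mono' (hu2.add hv2) ?_ ?_
  · exact ((hu.mul hv).div (h.continuousOn_sigW.mono Ioo_subset_Icc_self)
      fun x hx => (hσ x hx).ne').aestronglyMeasurable measurableSet_Ioo
  · filter_upwards [ae_restrict_mem measurableSet_Ioo] with x hx
    rw [Pi.add_apply, ← add_div, Real.norm_eq_abs, abs_div, abs_of_pos (hσ x hx), abs_mul]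
    refine div_le_div_of_nonneg_right ?_ (hσ x hx).le
    nlinarith [sq_nonneg (|u x| - |v x|), sq_abs (u x), sq_abs (v x), sq_nonneg (u x),
      sq_nonneg (v x)]

theorem MemH1sig0.sq_le {a b u u' : ℝ → ℝ} (hu : MemH1sig0 a b u u')
    (hm : AEStronglyMeasurable u' (volume.restrict (Ioo 0 1))) {x : ℝ} (hx : x ∈ Ioc (0:ℝ) 1) :
    u x ^ 2 ≤ x * ∫ t in Ioo (0:ℝ) 1, u' t ^ 2 := by
  have hsub : Ioo (0:ℝ) x ⊆ Ioo 0 1 := Ioo_subset_Ioo_right hx.2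
  rw [hu.ftc x ⟨hx.1.le, hx.2⟩, hu.zero, zero_add]
  refine (sq_integral_Ioo_le hx.1 (hm.mono_measure (Measure.restrict_mono_set _ hsub))
    (hu.deriv_sq_int.mono_set hsub)).trans (mul_le_mul_of_nonneg_left ?_ hx.1.le)
  exact setIntegral_mono_set hu.deriv_sq_int (ae_of_all _ fun t => sq_nonneg _)
    hsub.eventuallyLE

namespace ClassicalSol

variable {a a' b : ℝ → ℝ} {K β : ℝ} {y yt yx ytt ytx yxx : ℝ → ℝ → ℝ}

theorem continuousOn_yx (hy : ClassicalSol a b β y yt yx ytt ytx yxx) {t : ℝ} (ht : 0 ≤ t) :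
    ContinuousOn (yx t) (Ioc 0 1) :=
  fun x hx => (hy.dxx t x ht hx).continuousAt.continuousWithinAt

theorem continuousOn_ytx (hy : ClassicalSol a b β y yt yx ytt ytx yxx) {t : ℝ} (ht : 0 ≤ t) :
    ContinuousOn (ytx t) (Ioc 0 1) :=
  hy.cont_tx.comp (f := fun x => (t, x)) (by fun_prop) fun _ hx => ⟨ht, hx⟩

theorem continuousOn_ytt (hy : ClassicalSol a b β y yt yx ytt ytx yxx) {t : ℝ} (ht : 0 ≤ t) :
    ContinuousOn (ytt t) (Ioc 0 1) :=
  hy.cont_tt.comp (f := fun x => (t, x)) (by fun_prop) fun _ hx => ⟨ht, hx⟩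

theorem continuousOn_y_time (hy : ClassicalSol a b β y yt yx ytt ytx yxx) {x : ℝ}
    (hx : x ∈ Icc (0:ℝ) 1) : ContinuousOn (fun t => y t x) (Ici 0) :=
  fun t ht => (hy.dt t x ht hx).continuousAt.continuousWithinAt

theorem continuousOn_yt_time (hy : ClassicalSol a b β y yt yx ytt ytx yxx) {x : ℝ}
    (hx : x ∈ Icc (0:ℝ) 1) : ContinuousOn (fun t => yt t x) (Ici 0) :=
  fun t ht => (hy.dtt t x ht hx).continuousAt.continuousWithinAt

theorem hasDerivAt_flux (hy : ClassicalSol a b β y yt yx ytt ytx yxx) (h : HypH1 a a' b K)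
    {t x : ℝ} (ht : 0 < t) (hx : x ∈ Ioo (0:ℝ) 1) :
    HasDerivAt (fun ξ => etaW a b ξ * yx t ξ) (ytt t x / sigW a b x) x := by
  refine ((h.hasDerivAt_etaW hx).mul
    (hy.dxx t x ht.le (Ioo_subset_Ioc_self hx))).congr_deriv ?_
  have ha := (h.coeff.2.1 x (Ioo_subset_Ioc_self hx)).ne'
  have he := (etaW_pos a b x).ne'
  rw [hy.pde t x ht hx, sigW]
  field_simp
  ring

theorem continuousOn_flux (hy : ClassicalSol a b β y yt yx ytt ytx yxx) (h : HypH1 a a' b K)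
    {t : ℝ} (ht : 0 ≤ t) : ContinuousOn (fun ξ => etaW a b ξ * yx t ξ) (Ioc 0 1) :=
  (h.continuousOn_etaW.mono Ioc_subset_Icc_self).mul (hy.continuousOn_yx ht)

theorem integrableOn_kinetic (hy : ClassicalSol a b β y yt yx ytt ytx yxx) {t : ℝ}
    (ht : 0 ≤ t) : IntegrableOn (fun x => yt t x ^ 2 / sigW a b x) (Ioo 0 1) :=
  (hy.regt t ht).l2sig.2

theorem integrableOn_elastic (hy : ClassicalSol a b β y yt yx ytt ytx yxx)
    (h : HypH1 a a' b K) {t : ℝ} (ht : 0 ≤ t) :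
    IntegrableOn (fun x => etaW a b x * yx t x ^ 2) (Ioo 0 1) :=
  integrableOn_continuousOn_mul h.continuousOn_etaW (hy.regx t ht).deriv_sq_int

theorem aestronglyMeasurable_yx (hy : ClassicalSol a b β y yt yx ytt ytx yxx) {t : ℝ}
    (ht : 0 ≤ t) : AEStronglyMeasurable (yx t) (volume.restrict (Ioo 0 1)) :=
  ((hy.continuousOn_yx ht).mono Ioo_subset_Ioc_self).aestronglyMeasurable measurableSet_Ioo

theorem aestronglyMeasurable_ytx (hy : ClassicalSol a b β y yt yx ytt ytx yxx) {t : ℝ}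
    (ht : 0 ≤ t) : AEStronglyMeasurable (ytx t) (volume.restrict (Ioo 0 1)) :=
  ((hy.continuousOn_ytx ht).mono Ioo_subset_Ioc_self).aestronglyMeasurable measurableSet_Ioo

theorem integrableOn_ytt_sq_div (hy : ClassicalSol a b β y yt yx ytt ytx yxx)
    (h : HypH1 a a' b K) {t : ℝ} (ht : 0 < t) :
    IntegrableOn (fun x => ytt t x ^ 2 / sigW a b x) (Ioo 0 1) := by
  refine (hy.regx t ht.le).Au_l2sig.2.congr_fun (fun x hx => ?_) measurableSet_Ioo
  have ha := (h.coeff.2.1 x (Ioo_subset_Ioc_self hx)).ne'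
  have he := (etaW_pos a b x).ne'
  simp only
  rw [hy.pde t x ht hx, sigW]
  field_simp
  ring

/-- The boundary flux identity behind the dissipation of the energy. -/
theorem integral_energy_deriv (hy : ClassicalSol a b β y yt yx ytt ytx yxx)
    (h : HypH1 a a' b K) {t : ℝ} (ht : 0 < t) :
    ∫ x in Ioo (0:ℝ) 1,
      (2 * yt t x * ytt t x / sigW a b x + 2 * etaW a b x * yx t x * ytx t x)
      = 2 * (etaW a b 1 * yx t 1) * yt t 1 := by
  set N := ∫ x in Ioo (0:ℝ) 1, ytx t x ^ 2
  have hyt : ContinuousOn (yt t) (Icc 0 1) := (hy.regt t ht.le).cont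
  refine integral_Ioo_eq_of_sq_le (F := fun x => 2 * (etaW a b x * yx t x) * yt t x)
    (k := fun x => 4 * N * etaW a b x * (etaW a b x * yx t x ^ 2)) ?_ ?_ ?_ ?_ ?_
  · exact (continuousOn_const.mul (hy.continuousOn_flux h ht.le)).mul
      (hyt.mono Ioc_subset_Icc_self)
  · intro x hx
    refine (((hy.hasDerivAt_flux h ht hx).const_mul 2).mul
      (hy.dtx t x ht.le (Ioo_subset_Ioc_self hx))).congr_deriv ?_
    ring
  · refine Integrable.add ?_ ?_
    · have := (h.integrableOn_mul_div (hyt.mono Ioo_subset_Icc_self)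
        ((hy.continuousOn_ytt ht.le).mono Ioo_subset_Ioc_self) (hy.integrableOn_kinetic ht.le)
        (hy.integrableOn_ytt_sq_div h ht)).const_mul 2
      exact this.congr (ae_of_all _ fun x => by ring)
    · have := (integrableOn_continuousOn_mul h.continuousOn_etaW
        (integrableOn_mul_of_sq (hy.aestronglyMeasurable_yx ht.le)
          (hy.aestronglyMeasurable_ytx ht.le) (hy.regx t ht.le).deriv_sq_int
          (hy.regt t ht.le).deriv_sq_int)).const_mul 2
      exact this.congr (ae_of_all _ fun x => by ring)
  · exact integrableOn_continuousOn_mul (continuousOn_const.mul h.continuousOn_etaW)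
      (hy.integrableOn_elastic h ht.le)
  · intro x hx
    have h1 := (hy.regt t ht.le).sq_le (hy.aestronglyMeasurable_ytx ht.le)
      (Ioo_subset_Ioc_self hx)
    have h2 := mul_le_mul_of_nonneg_left h1 (sq_nonneg (2 * (etaW a b x * yx t x)))
    calc (2 * (etaW a b x * yx t x) * yt t x) ^ 2
        = (2 * (etaW a b x * yx t x)) ^ 2 * yt t x ^ 2 := by ring
      _ ≤ (2 * (etaW a b x * yx t x)) ^ 2 * (x * N) := h2
      _ = _ := by ring

theorem hasDerivAt_energy (hy : ClassicalSol a b β y yt yx ytt ytx yxx)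
    (h : HypH1 a a' b K) {t : ℝ} (ht : 0 < t) :
    HasDerivAt (energy a b β y yt yx) (-(yt t 1) ^ 2) t := by
  have h1 := (((hy.ediff t ht.le).add
    (((hy.dt t 1 ht.le (by simp)).pow 2).const_mul β)).const_mul (1/2))
  refine h1.congr_deriv ?_
  rw [hy.integral_energy_deriv h ht,
    show etaW a b 1 * yx t 1 = -yt t 1 - β * y t 1 by linarith [hy.bc1 t ht]]
  norm_num
  ring

theorem integral_yt_sq_one (hy : ClassicalSol a b β y yt yx ytt ytx yxx)
    (h : HypH1 a a' b K) {s T : ℝ} (hs : 0 < s) (hT : s ≤ T) :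
    ∫ t in s..T, yt t 1 ^ 2 = energy a b β y yt yx s - energy a b β y yt yx T := by
  have hpos : ∀ t ∈ uIcc s T, 0 < t := fun t ht => by
    rw [uIcc_of_le hT] at ht; exact hs.trans_le ht.1
  have hc : ContinuousOn (fun t => yt t 1 ^ 2) (uIcc s T) :=
    ((hy.continuousOn_yt_time (by simp)).pow 2).mono fun t ht => (hpos t ht).le
  have := intervalIntegral.integral_eq_sub_of_hasDerivAt
    (fun t ht => hy.hasDerivAt_energy h (hpos t ht)) (hc.intervalIntegrable.neg)
  rw [intervalIntegral.integral_neg] at this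
  linarith

theorem energy_eq (hy : ClassicalSol a b β y yt yx ytt ytx yxx) (h : HypH1 a a' b K) {t : ℝ}
    (ht : 0 ≤ t) : 2 * energy a b β y yt yx t =
      (∫ x in Ioo (0:ℝ) 1, yt t x ^ 2 / sigW a b x)
        + (∫ x in Ioo (0:ℝ) 1, etaW a b x * yx t x ^ 2) + β * y t 1 ^ 2 := by
  rw [energy, integral_add (hy.integrableOn_kinetic ht) (hy.integrableOn_elastic h ht)]
  ring

theorem kinetic_nonneg (h : HypH1 a a' b K) (t : ℝ) :
    0 ≤ ∫ x in Ioo (0:ℝ) 1, yt t x ^ 2 / sigW a b x :=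
  setIntegral_nonneg measurableSet_Ioo fun _ hx =>
    div_nonneg (sq_nonneg _) (h.sigW_pos (Ioo_subset_Ioc_self hx)).le

theorem elastic_nonneg (a b : ℝ → ℝ) (yx : ℝ → ℝ → ℝ) (t : ℝ) :
    0 ≤ ∫ x in Ioo (0:ℝ) 1, etaW a b x * yx t x ^ 2 :=
  setIntegral_nonneg measurableSet_Ioo fun x _ =>
    mul_nonneg (etaW_pos a b x).le (sq_nonneg _)

theorem sq_le_elastic (hy : ClassicalSol a b β y yt yx ytt ytx yxx) (h : HypH1 a a' b K)
    {t x : ℝ} (ht : 0 ≤ t) (hx : x ∈ Ioc (0:ℝ) 1) :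
    y t x ^ 2 ≤ x * ((∫ x in Ioo (0:ℝ) 1, etaW a b x * yx t x ^ 2)
      / sInf (etaW a b '' Icc 0 1)) := by
  have h0 : MemH1sig0 a b (y t) (yx t) := ⟨(hy.regx t ht).toMemH1sig, (hy.regx t ht).zero⟩
  refine (h0.sq_le (hy.aestronglyMeasurable_yx ht) hx).trans
    (mul_le_mul_of_nonneg_left ?_ hx.1.le)
  rw [le_div_iff₀ h.sInf_etaW_pos, mul_comm, ← integral_const_mul]
  exact setIntegral_mono_on (h0.deriv_sq_int.const_mul _) (hy.integrableOn_elastic h ht)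
    measurableSet_Ioo fun x hx =>
      mul_le_mul_of_nonneg_right (h.sInf_etaW_le (Ioo_subset_Icc_self hx)) (sq_nonneg _)

end ClassicalSol

namespace ClassicalSol

variable {a a' b : ℝ → ℝ} {K β : ℝ} {y yt yx ytt ytx yxx : ℝ → ℝ → ℝ}

theorem kinetic_le (hy : ClassicalSol a b β y yt yx ytt ytx yxx) (h : HypH1 a a' b K)
    (hβ : 0 ≤ β) {t : ℝ} (ht : 0 ≤ t) :
    ∫ x in Ioo (0:ℝ) 1, yt t x ^ 2 / sigW a b x ≤ 2 * energy a b β y yt yx t := by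
  rw [hy.energy_eq h ht]
  nlinarith [elastic_nonneg a b yx t, sq_nonneg (y t 1)]

theorem elastic_le (hy : ClassicalSol a b β y yt yx ytt ytx yxx) (h : HypH1 a a' b K)
    (hβ : 0 ≤ β) {t : ℝ} (ht : 0 ≤ t) :
    ∫ x in Ioo (0:ℝ) 1, etaW a b x * yx t x ^ 2 ≤ 2 * energy a b β y yt yx t := by
  rw [hy.energy_eq h ht]
  nlinarith [kinetic_nonneg (yt := yt) h t, sq_nonneg (y t 1)]

theorem energy_nonneg (hy : ClassicalSol a b β y yt yx ytt ytx yxx) (h : HypH1 a a' b K)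
    (hβ : 0 ≤ β) {t : ℝ} (ht : 0 ≤ t) : 0 ≤ energy a b β y yt yx t := by
  linarith [hy.elastic_le h hβ ht, elastic_nonneg a b yx t]

theorem energy_le (hy : ClassicalSol a b β y yt yx ytt ytx yxx)
    (h : HypH1 a a' b K) {s T : ℝ} (hs : 0 < s) (hT : s ≤ T) :
    energy a b β y yt yx T ≤ energy a b β y yt yx s := by
  have := intervalIntegral.integral_nonneg (μ := volume) hT fun t _ => sq_nonneg (yt t 1)
  linarith [hy.integral_yt_sq_one h hs hT]

theorem sq_le_energy (hy : ClassicalSol a b β y yt yx ytt ytx yxx) (h : HypH1 a a' b K)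
    (hβ : 0 ≤ β) {t x : ℝ} (ht : 0 ≤ t) (hx : x ∈ Ioc (0:ℝ) 1) :
    y t x ^ 2 ≤ x * (2 * energy a b β y yt yx t / sInf (etaW a b '' Icc 0 1)) :=
  (hy.sq_le_elastic h ht hx).trans <| mul_le_mul_of_nonneg_left
    (div_le_div_of_nonneg_right (hy.elastic_le h hβ ht) h.sInf_etaW_pos.le) hx.1.le

theorem continuousOn_kernel (hy : ClassicalSol a b β y yt yx ytt ytx yxx)
    (h : HypH1 a a' b K) : ContinuousOn
      (Function.uncurry fun t x => scaleW a b x / sigW a b x * ytt t x)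
      (Ici 0 ×ˢ Ioc (0:ℝ) 1) := by
  have hc : ContinuousOn (fun x => scaleW a b x / sigW a b x) (Ioc 0 1) :=
    (h.continuousOn_scaleW.mono Ioc_subset_Icc_self).div
      (h.continuousOn_sigW.mono Ioc_subset_Icc_self) fun x hx => (h.sigW_pos hx).ne'
  exact (hc.comp continuousOn_snd fun _ hp => hp.2).mul hy.cont_tt

theorem integrableOn_kernel (hy : ClassicalSol a b β y yt yx ytt ytx yxx)
    (h : HypH1 a a' b K) {s T ε : ℝ} (hs : 0 < s) (hε : 0 < ε) :
    IntegrableOn (Function.uncurry fun t x => scaleW a b x / sigW a b x * ytt t x)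
      (Icc s T ×ˢ Icc ε 1) :=
  ((hy.continuousOn_kernel h).mono (prod_mono (fun _ ht => hs.le.trans ht.1)
    fun _ hx => ⟨hε.trans_le hx.1, hx.2⟩)).integrableOn_compact
      (isCompact_Icc.prod isCompact_Icc)

theorem integral_kernel_space (hy : ClassicalSol a b β y yt yx ytt ytx yxx)
    (h : HypH1 a a' b K) {t ε : ℝ} (ht : 0 < t) (hε : ε ∈ Ioo (0:ℝ) 1) :
    ∫ x in ε..1, scaleW a b x / sigW a b x * ytt t x =
      (scaleW a b 1 * (etaW a b 1 * yx t 1) - y t 1)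
        - (scaleW a b ε * (etaW a b ε * yx t ε) - y t ε) := by
  have hsub : Icc ε 1 ⊆ Ioc 0 1 := fun x hx => ⟨hε.1.trans_le hx.1, hx.2⟩
  refine intervalIntegral.integral_eq_sub_of_hasDerivAt_of_le hε.2.le
    (f := fun x => scaleW a b x * (etaW a b x * yx t x) - y t x) ?_ ?_ ?_
  · exact ((h.continuousOn_scaleW.mono (hsub.trans Ioc_subset_Icc_self)).mul
      ((hy.continuousOn_flux h ht.le).mono hsub)).sub
        ((hy.regx t ht.le).cont.mono (hsub.trans Ioc_subset_Icc_self))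
  · intro x hx
    have hx' : x ∈ Ioo (0:ℝ) 1 := ⟨hε.1.trans hx.1, hx.2⟩
    refine (((h.hasDerivAt_scaleW hx').mul (hy.hasDerivAt_flux h ht hx')).sub
      (hy.dx t x ht.le (Ioo_subset_Ioc_self hx'))).congr_deriv ?_
    have he := (etaW_pos a b x).ne'
    field_simp
    ring
  · refine ContinuousOn.intervalIntegrable_of_Icc hε.2.le ?_
    exact (hy.continuousOn_kernel h).comp (f := fun x => (t, x)) (by fun_prop)
      fun x hx => ⟨ht.le, hsub hx⟩

theorem integral_kernel_swap (hy : ClassicalSol a b β y yt yx ytt ytx yxx)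
    (h : HypH1 a a' b K) {s T ε : ℝ} (hs : 0 < s) (hT : s ≤ T) (hε : ε ∈ Ioo (0:ℝ) 1) :
    ∫ t in s..T, ∫ x in ε..1, scaleW a b x / sigW a b x * ytt t x =
      ∫ x in ε..1, (scaleW a b x * yt T x / sigW a b x - scaleW a b x * yt s x / sigW a b x) := by
  rw [intervalIntegral_intervalIntegral_swap ((hy.integrableOn_kernel h hs hε.1).mono_set
    (by rw [uIoc_of_le hT, uIoc_of_le hε.2.le]
        exact prod_mono Ioc_subset_Icc_self Ioc_subset_Icc_self))]
  refine intervalIntegral.integral_congr fun x hx => ?_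
  rw [uIcc_of_le hε.2.le] at hx
  have hx' : x ∈ Ioc (0:ℝ) 1 := ⟨hε.1.trans_le hx.1, hx.2⟩
  rw [intervalIntegral.integral_const_mul,
    intervalIntegral.integral_eq_sub_of_hasDerivAt_of_le hT
      (f := fun t => yt t x)
      ((hy.continuousOn_yt_time (Ioc_subset_Icc_self hx')).mono fun t ht => hs.le.trans ht.1)
      (fun t ht => hy.dtt t x (hs.le.trans ht.1.le) (Ioc_subset_Icc_self hx'))]
  · ring
  · refine ContinuousOn.intervalIntegrable_of_Icc hT ?_
    exact hy.cont_tt.comp (f := fun t => (t, x)) (by fun_prop)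
      fun t ht => ⟨hs.le.trans ht.1, hx'⟩

theorem integrableOn_pairing (hy : ClassicalSol a b β y yt yx ytt ytx yxx)
    (h : HypH1 a a' b K) {t : ℝ} (ht : 0 ≤ t) :
    IntegrableOn (fun x => scaleW a b x * yt t x / sigW a b x) (Ioo 0 1) :=
  h.integrableOn_mul_div (h.continuousOn_scaleW.mono Ioo_subset_Icc_self)
    ((hy.regt t ht).cont.mono Ioo_subset_Icc_self) h.integrableOn_scaleW_sq_div
    (hy.integrableOn_kinetic ht)

theorem tendsto_integral_trace (hy : ClassicalSol a b β y yt yx ytt ytx yxx)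
    (h : HypH1 a a' b K) (hβ : 0 ≤ β) {s T : ℝ} (hs : 0 < s) (hT : s ≤ T) :
    Tendsto (fun ε => ∫ t in s..T, y t ε) (𝓝[>] 0) (𝓝 0) := by
  set B := 2 * energy a b β y yt yx s / sInf (etaW a b '' Icc 0 1)
  have hlim : Tendsto (fun ε : ℝ => √(ε * B) * |T - s|) (𝓝[>] 0) (𝓝 0) := by
    have : Continuous fun ε : ℝ => √(ε * B) * |T - s| := by fun_prop
    simpa using (this.tendsto 0).mono_left nhdsWithin_le_nhds
  refine squeeze_zero_norm' ?_ hlim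
  filter_upwards [eventually_mem_Ioo_nhdsGT] with ε hε
  refine intervalIntegral.norm_integral_le_of_norm_le_const fun t ht => ?_
  rw [uIoc_of_le hT] at ht
  refine Real.abs_le_sqrt ((hy.sq_le_energy h hβ (hs.trans ht.1).le
    (Ioo_subset_Ioc_self hε)).trans (mul_le_mul_of_nonneg_left ?_ hε.1.le))
  refine div_le_div_of_nonneg_right ?_ h.sInf_etaW_pos.le
  linarith [hy.energy_le h hs ht.1.le]

theorem ae_abs_integral_flux_le (hy : ClassicalSol a b β y yt yx ytt ytx yxx)
    (h : HypH1 a a' b K) {s T : ℝ} (hs : 0 < s) (hT : s < T) :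
    ∃ k : ℝ → ℝ, IntegrableOn k (Ioo 0 1) ∧ ∀ᵐ x ∂volume.restrict (Ioo (0:ℝ) 1),
      |∫ t in s..T, scaleW a b x * (etaW a b x * yx t x)| ≤ x * k x := by
  set m := sInf (etaW a b '' Icc 0 1)
  have hm : 0 < m := h.sInf_etaW_pos
  have hint : Integrable (fun p : ℝ × ℝ => etaW a b p.2 * (yx p.1 p.2) ^ 2)
      ((volume.restrict (Ioo s T)).prod (volume.restrict (Ioo (0:ℝ) 1))) := by
    rw [Measure.prod_restrict]
    exact (hy.intQ s T hs hT).2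
  have hη : IntegrableOn (etaW a b) (Ioo 0 1) :=
    h.continuousOn_etaW.integrableOn_Icc.mono_set Ioo_subset_Icc_self
  refine ⟨fun x => m⁻¹ * ((T - s) * etaW a b x
    + ∫ t in Ioo s T, etaW a b x * yx t x ^ 2),
    ((hη.const_mul _).add hint.integral_prod_right).const_mul _, ?_⟩
  filter_upwards [hint.prod_left_ae, ae_restrict_mem measurableSet_Ioo] with x hxi hx
  have hxi' : IntervalIntegrable (fun t => etaW a b x * yx t x ^ 2) volume s T :=
    (intervalIntegrable_iff_integrableOn_Ioo_of_le hT.le).2 hxi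
  have hb : IntervalIntegrable
      (fun t => x * m⁻¹ * (etaW a b x + etaW a b x * yx t x ^ 2)) volume s T :=
    (intervalIntegrable_const.add hxi').const_mul _
  have hG := h.scaleW_le (Ioo_subset_Icc_self hx)
  have hG0 : 0 ≤ scaleW a b x := HypH1.scaleW_nonneg hx.1.le
  have hη0 := etaW_pos a b x
  rw [← Real.norm_eq_abs]
  refine (intervalIntegral.norm_integral_le_of_norm_le hT.le (ae_of_all _ fun t _ => ?_)
    hb).trans_eq ?_
  · rw [Real.norm_eq_abs, abs_mul, abs_mul, abs_of_nonneg hG0, abs_of_pos hη0,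
      ← div_eq_mul_inv]
    refine mul_le_mul hG ?_ (by positivity) (hG0.trans hG)
    have : |yx t x| ≤ 1 + yx t x ^ 2 := by
      nlinarith [sq_nonneg (|yx t x| - 1), sq_abs (yx t x)]
    nlinarith
  · rw [intervalIntegral.integral_const_mul,
      intervalIntegral.integral_add intervalIntegrable_const hxi',
      intervalIntegral.integral_const, smul_eq_mul, intervalIntegral.integral_of_le hT.le,
      integral_Ioc_eq_integral_Ioo, mul_assoc]

/-- Evolution of the pairing of `y_t` with `∫₀ˣ 1/η` in `L²_{1/σ}`, in integrated form. -/
theorem pairing_sub (hy : ClassicalSol a b β y yt yx ytt ytx yxx)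
    (h : HypH1 a a' b K) (hβ : 0 ≤ β) {s T : ℝ} (hs : 0 < s) (hT : s < T) :
    (∫ x in Ioo (0:ℝ) 1, scaleW a b x * yt T x / sigW a b x)
      - (∫ x in Ioo (0:ℝ) 1, scaleW a b x * yt s x / sigW a b x)
      = ∫ t in s..T, (-(scaleW a b 1 * yt t 1) - (1 + β * scaleW a b 1) * y t 1) := by
  obtain ⟨k, hk, hle⟩ := hy.ae_abs_integral_flux_le h hs hT
  set c : ℝ → ℝ := fun t => -(scaleW a b 1 * yt t 1) - (1 + β * scaleW a b 1) * y t 1 with hc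
  have hsub : Icc s T ⊆ Ici 0 := fun t ht => hs.le.trans ht.1
  have hone : (1:ℝ) ∈ Icc (0:ℝ) 1 := by simp
  have hci : IntervalIntegrable c volume s T := by
    refine ContinuousOn.intervalIntegrable_of_Icc hT.le ?_
    exact (continuousOn_const.mul ((hy.continuousOn_yt_time hone).mono hsub)).neg.sub
      (continuousOn_const.mul ((hy.continuousOn_y_time hone).mono hsub))
  have hTp : IntegrableOn (fun x => scaleW a b x * yt T x / sigW a b x
      - scaleW a b x * yt s x / sigW a b x) (Ioo 0 1) :=
    (hy.integrableOn_pairing h (hs.trans hT).le).sub (hy.integrableOn_pairing h hs.le)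
  have hlim : Tendsto (fun ε => ∫ t in s..T, scaleW a b ε * (etaW a b ε * yx t ε)) (𝓝[>] 0)
      (𝓝 ((∫ t in s..T, c t) + 0 - ∫ x in Ioo (0:ℝ) 1,
        (scaleW a b x * yt T x / sigW a b x - scaleW a b x * yt s x / sigW a b x))) := by
    refine ((tendsto_const_nhds.add (hy.tendsto_integral_trace h hβ hs hT.le)).sub
      (tendsto_integral_left hTp)).congr' ?_
    filter_upwards [eventually_mem_Ioo_nhdsGT] with ε hε
    have hyi : IntervalIntegrable (fun t => y t ε) volume s T :=
      ContinuousOn.intervalIntegrable_of_Icc hT.le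
        ((hy.continuousOn_y_time (Ioo_subset_Icc_self hε)).mono hsub)
    have hJ : IntervalIntegrable
        (fun t => ∫ x in ε..1, scaleW a b x / sigW a b x * ytt t x) volume s T := by
      rw [intervalIntegrable_iff_integrableOn_Ioc_of_le hT.le]
      simp only [intervalIntegral.integral_of_le hε.2.le]
      have := (hy.integrableOn_kernel h (T := T) hs hε.1).mono_set
        (prod_mono Ioc_subset_Icc_self Ioc_subset_Icc_self :
          Ioc s T ×ˢ Ioc ε 1 ⊆ Icc s T ×ˢ Icc ε 1)
      rw [IntegrableOn, Measure.volume_eq_prod, ← Measure.prod_restrict] at this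
      exact this.integral_prod_left
    rw [← hy.integral_kernel_swap h hs hT.le hε, ← intervalIntegral.integral_add hci hyi,
      ← intervalIntegral.integral_sub (hci.add hyi) hJ]
    refine intervalIntegral.integral_congr fun t ht => ?_
    rw [uIcc_of_le hT.le] at ht
    have ht0 : 0 < t := hs.trans_le ht.1
    rw [hy.integral_kernel_space h ht0 hε,
      show etaW a b 1 * yx t 1 = -yt t 1 - β * y t 1 by linarith [hy.bc1 t ht0], hc]
    ring
  have := eq_zero_of_tendsto_of_abs_le_mul hlim hk hle
  rw [integral_sub (hy.integrableOn_pairing h (hs.trans hT).le)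
    (hy.integrableOn_pairing h hs.le)] at this
  linarith

theorem hasDerivAt_pairing (hy : ClassicalSol a b β y yt yx ytt ytx yxx)
    (h : HypH1 a a' b K) (hβ : 0 ≤ β) {t : ℝ} (ht : 0 < t) :
    HasDerivAt (fun t => ∫ x in Ioo (0:ℝ) 1, scaleW a b x * yt t x / sigW a b x)
      (-(scaleW a b 1 * yt t 1) - (1 + β * scaleW a b 1) * y t 1) t := by
  have hone : (1:ℝ) ∈ Icc (0:ℝ) 1 := by simp
  have ht2 : t / 2 < t := half_lt_self ht
  have hc : ContinuousOn
      (fun t => -(scaleW a b 1 * yt t 1) - (1 + β * scaleW a b 1) * y t 1) (Ici 0) :=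
    (continuousOn_const.mul (hy.continuousOn_yt_time hone)).neg.sub
      (continuousOn_const.mul (hy.continuousOn_y_time hone))
  have h1 := intervalIntegral.integral_hasDerivAt_right (a := t / 2) (b := t)
    (ContinuousOn.intervalIntegrable_of_Icc ht2.le
      (hc.mono fun r hr => (half_pos ht).le.trans hr.1))
    ((hc.mono Ioi_subset_Ici_self).stronglyMeasurableAtFilter isOpen_Ioi t ht)
    (hc.continuousAt (Ici_mem_nhds ht))
  refine (h1.const_add
    (∫ x in Ioo (0:ℝ) 1, scaleW a b x * yt (t / 2) x / sigW a b x)).congr_of_eventuallyEq ?_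
  filter_upwards [Ioi_mem_nhds ht2] with r hr
  rw [← hy.pairing_sub h hβ (half_pos ht) hr]
  ring

theorem two_mul_pairing_le (hy : ClassicalSol a b β y yt yx ytt ytx yxx)
    (h : HypH1 a a' b K) {t : ℝ} (ht : 0 ≤ t) (κ : ℝ) :
    2 * κ * (∫ x in Ioo (0:ℝ) 1, scaleW a b x * yt t x / sigW a b x) ≤
      κ ^ 2 * (∫ x in Ioo (0:ℝ) 1, scaleW a b x ^ 2 / sigW a b x)
        + ∫ x in Ioo (0:ℝ) 1, yt t x ^ 2 / sigW a b x := by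
  rw [← integral_const_mul, ← integral_const_mul,
    ← integral_add (h.integrableOn_scaleW_sq_div.const_mul _) (hy.integrableOn_kinetic ht)]
  refine setIntegral_mono_on ((hy.integrableOn_pairing h ht).const_mul _)
    ((h.integrableOn_scaleW_sq_div.const_mul _).add (hy.integrableOn_kinetic ht))
    measurableSet_Ioo fun x hx => ?_
  have h1 : 0 ≤ (κ * scaleW a b x - yt t x) ^ 2 / sigW a b x :=
    div_nonneg (sq_nonneg _) (h.sigW_pos (Ioo_subset_Ioc_self hx)).le
  have h2 : (κ * scaleW a b x - yt t x) ^ 2 / sigW a b x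
      = κ ^ 2 * (scaleW a b x ^ 2 / sigW a b x) + yt t x ^ 2 / sigW a b x
        - 2 * κ * (scaleW a b x * yt t x / sigW a b x) := by ring
  linarith

end ClassicalSol

/-- The boundary estimate of Proposition 3.4. -/
theorem stmt16 (a a' b : ℝ → ℝ) (K β C_HP : ℝ) (y yt yx ytt ytx yxx : ℝ → ℝ → ℝ)
    (hH1 : HypH1 a a' b K) (hβ : 0 ≤ β) (hC_HP : 0 < C_HP)
    (hHP : ∀ v v' : ℝ → ℝ, MemH1sig0 a b v v' →
      ∫ x in Set.Ioo (0:ℝ) 1, (v x) ^ 2 / sigW a b x ≤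
        C_HP * ∫ x in Set.Ioo (0:ℝ) 1, (v' x) ^ 2)
    (hy : ClassicalSol a b β y yt yx ytt ytx yxx) :
    ∀ s T δ : ℝ, 0 < s → s < T → 0 < δ →
      (∫ t in Set.Ioo s T, (y t 1) ^ 2) ≤
        (2 + 2 * C_HP / (sInf (etaW a b '' Set.Icc 0 1)) ^ 3 + 1 / δ
            + (1 / δ) * (sSup (etaW a b '' Set.Icc 0 1) + C_HP)
              / (sInf (etaW a b '' Set.Icc 0 1)) ^ 2) *
          energy a b β y yt yx s
        + 2 * δ * (1 / (sInf (etaW a b '' Set.Icc 0 1)) ^ 3 + 1) *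
            ∫ t in Set.Ioo s T, energy a b β y yt yx t := by

  intro s T δ hs hT hδ
  set m := sInf (etaW a b '' Icc 0 1)
  set M := sSup (etaW a b '' Icc 0 1)
  set E := energy a b β y yt yx
  set A := ∫ x in Ioo (0:ℝ) 1, scaleW a b x ^ 2 / sigW a b x
  set G := scaleW a b 1
  set Φ : ℝ → ℝ := fun t => ∫ x in Ioo (0:ℝ) 1, scaleW a b x * yt t x / sigW a b x
  set P : ℝ → ℝ := fun t => ∫ x in Ioo (0:ℝ) 1, yt t x ^ 2 / sigW a b x
  have hm : 0 < m := hH1.sInf_etaW_pos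
  have hM : 0 ≤ M := hH1.sSup_etaW_nonneg
  have hA : A ≤ C_HP / m ^ 2 := hH1.integral_scaleW_sq_div_le hC_HP hHP
  have hG0 : 0 ≤ G := HypH1.scaleW_nonneg zero_le_one
  have hG : G ≤ 1 / m := hH1.scaleW_le (by simp)
  have hone : (1:ℝ) ∈ Icc (0:ℝ) 1 := by simp
  have hpos : ∀ t ∈ Icc s T, 0 < t := fun t ht => hs.trans_le ht.1
  have hsub : Icc s T ⊆ Ici 0 := fun t ht => (hpos t ht).le
  have hyc := (hy.continuousOn_y_time hone).mono hsub
  have hytc := (hy.continuousOn_yt_time hone).mono hsub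
  have hEc : ContinuousOn E (Icc s T) := fun t ht =>
    (hy.hasDerivAt_energy hH1 (hpos t ht)).continuousAt.continuousWithinAt
  have hΦc : ContinuousOn Φ (Icc s T) := fun t ht =>
    (hy.hasDerivAt_pairing hH1 hβ (hpos t ht)).continuousAt.continuousWithinAt
  have hpair : ∀ t, 0 ≤ t → ∀ κ : ℝ, 2 * κ * Φ t ≤ κ ^ 2 * A + P t := fun t ht κ =>
    hy.two_mul_pairing_le hH1 ht κ
  have hP2 : ∀ t, 0 ≤ t → P t ≤ 2 * E t := fun t ht => hy.kinetic_le hH1 hβ ht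
  have hE0 : ∀ t, 0 ≤ t → 0 ≤ E t := fun t ht => hy.energy_nonneg hH1 hβ ht
  have hy2 : ∀ t, 0 ≤ t → y t 1 ^ 2 ≤ 2 * E t / m := fun t ht => by
    simpa using hy.sq_le_energy hH1 hβ ht (x := 1) (by simp)
  set D : ℝ → ℝ := fun t => yt t 1 * Φ t + y t 1 * (-(G * yt t 1) - (1 + β * G) * y t 1) with hD
  have hDc : ContinuousOn D (Icc s T) := (hytc.mul hΦc).add (hyc.mul
    ((continuousOn_const.mul hytc).neg.sub (continuousOn_const.mul hyc)))
  have hDint : ∫ t in s..T, D t = y T 1 * Φ T - y s 1 * Φ s := by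
    refine intervalIntegral.integral_eq_sub_of_hasDerivAt (f := fun t => y t 1 * Φ t)
      (fun t ht => ?_) (hDc.intervalIntegrable_of_Icc hT.le)
    rw [uIcc_of_le hT.le] at ht
    exact (hy.dt t 1 (hpos t ht).le hone).mul (hy.hasDerivAt_pairing hH1 hβ (hpos t ht))
  have hbdry : ∀ t, 0 ≤ t → ∀ κ : ℝ, κ ^ 2 = y t 1 ^ 2 → κ * Φ t ≤ (1 + C_HP / m ^ 3) * E t := by
    intro t ht κ hκ
    have h1 := hpair t ht κ
    have h2 : κ ^ 2 * A ≤ 2 * E t / m * (C_HP / m ^ 2) :=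
      (mul_le_mul_of_nonneg_left hA (sq_nonneg κ)).trans
        (mul_le_mul_of_nonneg_right (hκ ▸ hy2 t ht) (by positivity))
    have h3 : 2 * E t / m * (C_HP / m ^ 2) = 2 * (C_HP / m ^ 3 * E t) := by
      field_simp
    linarith [hP2 t ht]
  have hpt : ∀ t ∈ Icc s T, y t 1 ^ 2 ≤
      -D t + (1 / (4 * δ) + 1 / (4 * δ) * (C_HP / m ^ 2)) * yt t 1 ^ 2
        + 2 * δ * (1 / m ^ 3 + 1) * E t := by
    intro t ht
    have ht0 := (hpos t ht).le
    have h1 : yt t 1 * Φ t ≤ 1 / (4 * δ) * (C_HP / m ^ 2) * yt t 1 ^ 2 + 2 * δ * E t := by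
      have h2 := mul_le_mul_of_nonneg_left (hpair t ht0 (yt t 1 / (2 * δ))) hδ.le
      have h3 : δ * (2 * (yt t 1 / (2 * δ)) * Φ t) = yt t 1 * Φ t := by field_simp
      have h4 : δ * ((yt t 1 / (2 * δ)) ^ 2 * A + P t)
          = 1 / (4 * δ) * yt t 1 ^ 2 * A + δ * P t := by
        field_simp; ring
      have h5 := mul_le_mul_of_nonneg_left hA
        (by positivity : 0 ≤ 1 / (4 * δ) * yt t 1 ^ 2)
      have h6 := mul_le_mul_of_nonneg_left (hP2 t ht0) hδ.le
      linarith
    have h2 : -(G * y t 1 * yt t 1) ≤ 1 / (4 * δ) * yt t 1 ^ 2 + 2 * δ * (1 / m ^ 3) * E t := by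
      have h3 : G ^ 2 * y t 1 ^ 2 ≤ (1 / m) ^ 2 * (2 * E t / m) :=
        mul_le_mul (pow_le_pow_left₀ hG0 hG 2) (hy2 t ht0) (sq_nonneg _) (by positivity)
      have h4 : δ * ((1 / m) ^ 2 * (2 * E t / m)) = 2 * δ * (1 / m ^ 3) * E t := by
        field_simp
      have h5 := mul_le_mul_of_nonneg_left h3 hδ.le
      have h6 : 0 ≤ δ * (G * y t 1 + yt t 1 / (2 * δ)) ^ 2 := by positivity
      have h7 : δ * (G * y t 1 + yt t 1 / (2 * δ)) ^ 2
          = δ * (G ^ 2 * y t 1 ^ 2) + G * y t 1 * yt t 1 + 1 / (4 * δ) * yt t 1 ^ 2 := by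
        field_simp; ring
      linarith
    have h3 : 0 ≤ β * G * y t 1 ^ 2 := by positivity
    have h4 : -D t = -(yt t 1 * Φ t) + G * y t 1 * yt t 1 + y t 1 ^ 2 + β * G * y t 1 ^ 2 := by
      simp only [hD]; ring
    linarith
  have hD' : IntervalIntegrable (fun t => -D t) volume s T :=
    (hDc.intervalIntegrable_of_Icc hT.le).neg
  have hy' : IntervalIntegrable (fun t => y t 1 ^ 2) volume s T :=
    (hyc.pow 2).intervalIntegrable_of_Icc hT.le
  have hyt' : IntervalIntegrable (fun t => (1 / (4 * δ) + 1 / (4 * δ) * (C_HP / m ^ 2))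
      * yt t 1 ^ 2) volume s T :=
    ((hytc.pow 2).intervalIntegrable_of_Icc hT.le).const_mul _
  have hE' := (hEc.intervalIntegrable_of_Icc (μ := volume) hT.le).const_mul
    (2 * δ * (1 / m ^ 3 + 1))
  have hmain := intervalIntegral.integral_mono_on hT.le hy' ((hD'.add hyt').add hE') hpt
  rw [intervalIntegral.integral_add (hD'.add hyt') hE', intervalIntegral.integral_add hD' hyt',
    intervalIntegral.integral_neg, intervalIntegral.integral_const_mul,
    intervalIntegral.integral_const_mul, hDint, hy.integral_yt_sq_one hH1 hs hT.le] at hmain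
  simp only [intervalIntegral.integral_of_le hT.le, integral_Ioc_eq_integral_Ioo] at hmain
  refine hmain.trans ?_
  have hsT : E T ≤ E s := hy.energy_le hH1 hs hT.le
  have hb1 := hbdry T (hs.trans hT).le (-y T 1) (by ring)
  have hb2 := hbdry s hs.le (y s 1) rfl
  have hb3 : (1 + C_HP / m ^ 3) * E T ≤ (1 + C_HP / m ^ 3) * E s :=
    mul_le_mul_of_nonneg_left hsT (by positivity)
  have hET := hE0 T (hs.trans hT).le
  have hEs := hE0 s hs.le
  have hc1 : (1 / (4 * δ) + 1 / (4 * δ) * (C_HP / m ^ 2)) * (E s - E T)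
      ≤ (1 / δ + (1 / δ) * (M + C_HP) / m ^ 2) * E s := by
    refine mul_le_mul ?_ (by linarith) (by linarith) (by positivity)
    have h1 : 1 / (4 * δ) ≤ 1 / δ := one_div_le_one_div_of_le hδ (by linarith)
    have h2 : C_HP / m ^ 2 ≤ (M + C_HP) / m ^ 2 :=
      div_le_div_of_nonneg_right (by linarith) (by positivity)
    have h3 := mul_le_mul h1 h2 (by positivity) (by positivity)
    rw [mul_div_assoc]
    linarith
  have hc2 : 2 * C_HP / m ^ 3 = 2 * (C_HP / m ^ 3) := by ring
  rw [hc2]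
  linarith
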